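/- Let U_A and U_B be 2×2 unitary complex matrices and suppose there exist 2×2 complex matrices V_A and V_B with CZ · (U_A ⊗ U_B) · CZ = V_A ⊗ V_B. Then U_A is diagonal or antidiagonal, and U_B is diagonal or antidiagonal. -/

import Mathlib

open Matrix Kronecker

/-- The controlled-Z gate as a `4 × 4` matrix, `diag(1, 1, 1, -1)`,
indexed by pairs of qubit basis states. -/
noncomputable def CZ : Matrix (Fin 2 × Fin 2) (Fin 2 × Fin 2) ℂ :=
  Matrix.diagonal fun p => if p = (1, 1) then -1 else 1

/-- A `2 × 2` matrix is diagonal when both off-diagonal entries vanish. -/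
def IsDiagonal2 (M : Matrix (Fin 2) (Fin 2) ℂ) : Prop :=
  M 0 1 = 0 ∧ M 1 0 = 0

/-- A `2 × 2` matrix is antidiagonal when both diagonal entries vanish. -/
def IsAntidiag2 (M : Matrix (Fin 2) (Fin 2) ℂ) : Prop :=
  M 0 0 = 0 ∧ M 1 1 = 0

theorem CZ_conj_kronecker_apply (A B : Matrix (Fin 2) (Fin 2) ℂ) (i j k l : Fin 2) :
    (CZ * (A ⊗ₖ B) * CZ) (i, j) (k, l) =
      (if (i, j) = (1, 1) then -1 else 1) * (A i k * B j l) *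
        (if (k, l) = (1, 1) then -1 else 1) := by
  simp only [CZ, Matrix.mul_diagonal, Matrix.diagonal_mul, Matrix.kroneckerMap_apply]

/-- If `CZ` conjugates `A ⊗ B` into a tensor product and `B` is invertible, then the first row of
`A` has a zero entry. -/
theorem left_row_mul_eq_zero {A B VA VB : Matrix (Fin 2) (Fin 2) ℂ}
    (hB : B.det ≠ 0) (h : CZ * (A ⊗ₖ B) * CZ = VA ⊗ₖ VB) : A 0 0 * A 0 1 = 0 := by
  have entry (i j k l : Fin 2) := (CZ_conj_kronecker_apply A B i j k l).symm.trans
    (congrFun (congrFun h (i, j)) (k, l))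
  have cross (j j' : Fin 2) : A 0 0 * A 0 1 * (B j 0 * B j' 1) = 0 := by
    have h₁ := entry 0 j 0 0
    have h₂ := entry 0 j' 1 1
    have h₃ := entry 0 j' 0 1
    have h₄ := entry 0 j 1 0
    simp at h₁ h₂ h₃ h₄
    linear_combination (1 / 2 : ℂ) * (A 0 1 * B j' 1 * h₁ - VA 0 0 * VB j 0 * h₂
      + A 0 1 * B j 0 * h₃ + VA 0 0 * VB j' 1 * h₄)
  refine (mul_eq_zero.mp ?_).resolve_right hB
  rw [Matrix.det_fin_two]
  linear_combination cross 0 1 - cross 1 0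

/-- If `CZ` conjugates `A ⊗ B` into a tensor product and `A` is invertible, then the first row of
`B` has a zero entry. -/
theorem right_row_mul_eq_zero {A B VA VB : Matrix (Fin 2) (Fin 2) ℂ}
    (hA : A.det ≠ 0) (h : CZ * (A ⊗ₖ B) * CZ = VA ⊗ₖ VB) : B 0 0 * B 0 1 = 0 := by
  refine left_row_mul_eq_zero (A := B) (VA := VB) (VB := VA) hA ?_
  ext ⟨i, j⟩ ⟨k, l⟩
  have e := congrFun (congrFun h (j, i)) (l, k)
  rw [CZ_conj_kronecker_apply, Matrix.kroneckerMap_apply] at e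
  rw [CZ_conj_kronecker_apply, Matrix.kroneckerMap_apply, mul_comm (VB i k), ← e,
    mul_comm (B i k)]
  simp only [Prod.mk.injEq, and_comm]

theorem det_ne_zero_of_mem_unitaryGroup {M : Matrix (Fin 2) (Fin 2) ℂ}
    (hM : M ∈ Matrix.unitaryGroup (Fin 2) ℂ) : M.det ≠ 0 :=
  Matrix.det_ne_zero_of_right_inverse (Matrix.mem_unitaryGroup_iff.mp hM)

/-- A unitary `2 × 2` matrix with a zero in its first row is diagonal or antidiagonal. -/
theorem isDiagonal2_or_isAntidiag2_of_row_mul_eq_zero {M : Matrix (Fin 2) (Fin 2) ℂ}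
    (hM : M ∈ Matrix.unitaryGroup (Fin 2) ℂ) (h : M 0 0 * M 0 1 = 0) :
    IsDiagonal2 M ∨ IsAntidiag2 M := by
  have hdet := det_ne_zero_of_mem_unitaryGroup hM
  have orth := congrFun (congrFun (Matrix.mem_unitaryGroup_iff.mp hM) 0) 1
  simp only [Matrix.mul_apply, Fin.sum_univ_two, Matrix.star_apply] at orth
  rw [Matrix.det_fin_two] at hdet
  rcases mul_eq_zero.mp h with h0 | h0
  · right
    simp_all [IsAntidiag2]
  · left
    simp_all [IsDiagonal2]

/-- (Necessity) If `CZ` conjugates `U_A ⊗ U_B` into a tensor product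
`V_A ⊗ V_B`, then `U_A` is diagonal or antidiagonal, and likewise `U_B`. -/
theorem cz_conjugation_necessity (UA UB : Matrix (Fin 2) (Fin 2) ℂ)
    (hA : UA ∈ Matrix.unitaryGroup (Fin 2) ℂ)
    (hB : UB ∈ Matrix.unitaryGroup (Fin 2) ℂ)
    (h : ∃ VA VB : Matrix (Fin 2) (Fin 2) ℂ, CZ * (UA ⊗ₖ UB) * CZ = VA ⊗ₖ VB) :
    (IsDiagonal2 UA ∨ IsAntidiag2 UA) ∧ (IsDiagonal2 UB ∨ IsAntidiag2 UB) := by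
  obtain ⟨VA, VB, h⟩ := h
  exact ⟨isDiagonal2_or_isAntidiag2_of_row_mul_eq_zero hA
      (left_row_mul_eq_zero (det_ne_zero_of_mem_unitaryGroup hB) h),
    isDiagonal2_or_isAntidiag2_of_row_mul_eq_zero hB
      (right_row_mul_eq_zero (det_ne_zero_of_mem_unitaryGroup hA) h)⟩
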